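/- Let n_{3,3} = V ⊕ ℝ^6 be a pseudo H-type Lie algebra built on a minimal admissible Cl_{3,3}-module V. Then for X ∈ V the linear map ad_X = [X,·] : V → ℝ^6 is surjective if and only if ⟨X,X⟩_V ≠ 0. -/

import Mathlib

/-- The standard scalar product of signature `(r,s)` on `ℝ^(r+s)`:
`⟨Z,W⟩_{r,s} = ∑_{i<r} Z i * W i - ∑_{r ≤ i < r+s} Z i * W i`. -/
def sform (r s : ℕ) (Z W : Fin (r + s) → ℝ) : ℝ :=
  ∑ i : Fin (r + s), (if (i : ℕ) < r then (1 : ℝ) else -1) * Z i * W i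

/-- `(V, B, J)` is an admissible module of the Clifford algebra `Cl_{r,s}`:
`V` is a nonzero finite-dimensional real vector space, `B` a nondegenerate
symmetric bilinear form on `V`, and `J : ℝ^{r+s} → End V` linear with
`J_Z ∘ J_Z = -⟨Z,Z⟩_{r,s} • id` and each `J_Z` skew-adjoint w.r.t. `B`. -/
def IsAdmissible (r s : ℕ) (V : Type) [AddCommGroup V] [Module ℝ V]
    (B : V →ₗ[ℝ] V →ₗ[ℝ] ℝ)
    (J : (Fin (r + s) → ℝ) →ₗ[ℝ] V →ₗ[ℝ] V) : Prop :=
  FiniteDimensional ℝ V ∧ Nontrivial V ∧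
  (∀ v w : V, B v w = B w v) ∧
  (∀ v : V, (∀ w : V, B v w = 0) → v = 0) ∧
  (∀ (Z : Fin (r + s) → ℝ) (v : V), J Z (J Z v) = (-(sform r s Z Z)) • v) ∧
  (∀ (Z : Fin (r + s) → ℝ) (v w : V), B (J Z v) w = -(B v (J Z w)))

/-- A minimal admissible `Cl_{r,s}`-module: one of least possible dimension. -/
def IsMinimalAdmissible (r s : ℕ) (V : Type) [AddCommGroup V] [Module ℝ V]
    (B : V →ₗ[ℝ] V →ₗ[ℝ] ℝ)
    (J : (Fin (r + s) → ℝ) →ₗ[ℝ] V →ₗ[ℝ] V) : Prop :=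
  IsAdmissible r s V B J ∧
  ∀ (V' : Type) [AddCommGroup V'] [Module ℝ V']
    (B' : V' →ₗ[ℝ] V' →ₗ[ℝ] ℝ)
    (J' : (Fin (r + s) → ℝ) →ₗ[ℝ] V' →ₗ[ℝ] V'),
    IsAdmissible r s V' B' J' → Module.finrank ℝ V ≤ Module.finrank ℝ V'

/-- `br` is the Lie bracket of the pseudo `H`-type Lie algebra `V ⊕ ℝ^{r+s}`
determined by the admissible module `(V,B,J)`, i.e.
`⟨Z, [v,w]⟩_{r,s} = ⟨J_Z v, w⟩_V` for all `Z, v, w`. -/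
def IsHBracket (r s : ℕ) (V : Type) [AddCommGroup V] [Module ℝ V]
    (B : V →ₗ[ℝ] V →ₗ[ℝ] ℝ)
    (J : (Fin (r + s) → ℝ) →ₗ[ℝ] V →ₗ[ℝ] V)
    (br : V →ₗ[ℝ] V →ₗ[ℝ] (Fin (r + s) → ℝ)) : Prop :=
  ∀ (Z : Fin (r + s) → ℝ) (v w : V), sform r s Z (br v w) = B (J Z v) w

/-- A linear equivalence `f` between the pseudo `H`-type Lie algebras
`V₁ ⊕ ℝ^{n₁}` and `V₂ ⊕ ℝ^{n₂}` (with 2-step brackets `br₁`, `br₂`, the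
`ℝ^{nᵢ}` factors being central) is a Lie algebra isomorphism. -/
def IsLieIso {V₁ : Type} [AddCommGroup V₁] [Module ℝ V₁]
    {V₂ : Type} [AddCommGroup V₂] [Module ℝ V₂] {n₁ n₂ : ℕ}
    (br₁ : V₁ →ₗ[ℝ] V₁ →ₗ[ℝ] (Fin n₁ → ℝ))
    (br₂ : V₂ →ₗ[ℝ] V₂ →ₗ[ℝ] (Fin n₂ → ℝ))
    (f : (V₁ × (Fin n₁ → ℝ)) ≃ₗ[ℝ] (V₂ × (Fin n₂ → ℝ))) : Prop :=
  ∀ x y : V₁ × (Fin n₁ → ℝ),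
    f (0, br₁ x.1 y.1) = (0, br₂ (f x).1 (f y).1)

section StandardForm

variable {r s : ℕ}

theorem sform_add_self (Z W : Fin (r + s) → ℝ) :
    sform r s (Z + W) (Z + W) = sform r s Z Z + 2 * sform r s Z W + sform r s W W := by
  simp only [sform, Finset.mul_sum, ← Finset.sum_add_distrib, Pi.add_apply]
  exact Finset.sum_congr rfl fun i _ => by ring

/-- Every linear functional on `ℝ^(r+s)` is represented by the standard scalar product. -/
theorem exists_sform_eq (f : (Fin (r + s) → ℝ) →ₗ[ℝ] ℝ) :
    ∃ Z : Fin (r + s) → ℝ, ∀ W, sform r s Z W = f W := by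
  refine ⟨fun i => (if (i : ℕ) < r then 1 else -1) * f (Pi.single i 1), fun W => ?_⟩
  rw [f.pi_apply_eq_sum_univ W, sform]
  refine Finset.sum_congr rfl fun i _ => ?_
  have h : (fun j => if i = j then (1 : ℝ) else 0) = Pi.single i 1 := by
    ext j
    simp [Pi.single_apply, eq_comm]
  rw [h]
  split_ifs <;> simp [mul_comm]

theorem eq_zero_of_sform_eq_zero {Z : Fin (r + s) → ℝ} (h : ∀ W, sform r s Z W = 0) :
    Z = 0 := by
  ext i
  have hi := h (Pi.single i 1)
  simp only [sform, Pi.single_apply, mul_ite, mul_one, mul_zero, Finset.sum_ite_eq',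
    Finset.mem_univ, if_true] at hi
  split_ifs at hi <;> simpa using hi

end StandardForm

section AdmissibleModules

variable {r s : ℕ} {V : Type} [AddCommGroup V] [Module ℝ V]
  {B : V →ₗ[ℝ] V →ₗ[ℝ] ℝ} {J : (Fin (r + s) → ℝ) →ₗ[ℝ] V →ₗ[ℝ] V}
  {br : V →ₗ[ℝ] V →ₗ[ℝ] (Fin (r + s) → ℝ)}

theorem IsAdmissible.apply_J_J (h : IsAdmissible r s V B J) (Z W : Fin (r + s) → ℝ) (X : V) :
    B (J Z X) (J W X) = sform r s Z W * B X X := by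
  obtain ⟨-, -, hsymm, -, hsq, hskew⟩ := h
  have hself (U : Fin (r + s) → ℝ) : B (J U X) (J U X) = sform r s U U * B X X := by
    rw [hskew, hsq]
    simp
  have hadd := hself (Z + W)
  rw [sform_add_self] at hadd
  simp only [map_add, LinearMap.add_apply] at hadd
  linarith [hself Z, hself W, hsymm (J Z X) (J W X)]

/-- If `X` is isotropic and `Z ↦ J_Z X` is injective, then its image is a totally isotropic
subspace of dimension `r + s`. -/
theorem IsAdmissible.two_mul_le_finrank (h : IsAdmissible r s V B J) {X : V} (hX : B X X = 0)
    (hinj : Function.Injective (J.flip X)) : 2 * (r + s) ≤ Module.finrank ℝ V := by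
  have happly := h.apply_J_J
  obtain ⟨hfin, -, hsymm, hnondeg, -, -⟩ := h
  have hrefl : LinearMap.IsRefl B := fun v w hvw => by rw [hsymm, hvw]
  have hB : LinearMap.BilinForm.Nondegenerate B :=
    hrefl.nondegenerate_iff_separatingLeft.mpr hnondeg
  have hle : LinearMap.range (J.flip X) ≤
      LinearMap.BilinForm.orthogonal B (LinearMap.range (J.flip X)) := by
    rintro _ ⟨W, rfl⟩ _ ⟨Z, rfl⟩
    simp [LinearMap.flip_apply, happly, hX]
  have hrank := Submodule.finrank_mono hle
  rw [LinearMap.BilinForm.finrank_orthogonal hB, LinearMap.finrank_range_of_inj hinj,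
    Module.finrank_fin_fun] at hrank
  have hrange := (LinearMap.range (J.flip X)).finrank_le
  rw [LinearMap.finrank_range_of_inj hinj, Module.finrank_fin_fun] at hrange
  omega

theorem IsAdmissible.injective_of_apply_self_ne_zero (h : IsAdmissible r s V B J) {X : V}
    (hX : B X X ≠ 0) : Function.Injective (J.flip X) := by
  refine (injective_iff_map_eq_zero _).mpr fun Z hZ => eq_zero_of_sform_eq_zero fun W => ?_
  rw [LinearMap.flip_apply] at hZ
  have := h.apply_J_J Z W X
  rw [hZ, map_zero, LinearMap.zero_apply] at this
  exact (mul_eq_zero.mp this.symm).resolve_right hX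

theorem IsAdmissible.surjective_bracket_iff (h : IsAdmissible r s V B J)
    (hbr : IsHBracket r s V B J br) (X : V) :
    Function.Surjective (br X) ↔ Function.Injective (J.flip X) := by
  obtain ⟨-, -, -, hnondeg, -, -⟩ := h
  constructor
  · intro hsurj
    refine (injective_iff_map_eq_zero _).mpr fun Z hZ => eq_zero_of_sform_eq_zero fun W => ?_
    obtain ⟨w, rfl⟩ := hsurj W
    rw [hbr, ← LinearMap.flip_apply J, hZ, map_zero, LinearMap.zero_apply]
  · intro hinj
    by_contra hsurj
    rw [← LinearMap.range_eq_top, ← ne_eq, ← lt_top_iff_ne_top] at hsurj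
    obtain ⟨f, hf, hker⟩ := Submodule.exists_le_ker_of_lt_top _ hsurj
    obtain ⟨Z, hZ⟩ := exists_sform_eq f
    refine hf (LinearMap.ext fun W => ?_)
    have hJ : J.flip X Z = 0 := by
      refine hnondeg _ fun w => ?_
      rw [LinearMap.flip_apply, ← hbr, hZ]
      exact hker ⟨w, rfl⟩
    rw [← hZ, (injective_iff_map_eq_zero _).mp hinj Z hJ]
    simp [sform]

end AdmissibleModules

section SplitModule

/-- The skew-symmetric matrix with Plücker coordinates `p = (p₁₂, p₁₃, p₁₄, p₂₃, p₂₄, p₃₄)`, in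
null coordinates for the form of signature `(3,3)`. -/
def skewMatrix (Z : Fin (3 + 3) → ℝ) : Matrix (Fin 4) (Fin 4) ℝ :=
  !![0, Z 0 + Z 3, Z 1 + Z 4, Z 2 + Z 5;
    -(Z 0 + Z 3), 0, Z 2 - Z 5, -(Z 1 - Z 4);
    -(Z 1 + Z 4), -(Z 2 - Z 5), 0, Z 0 - Z 3;
    -(Z 2 + Z 5), Z 1 - Z 4, -(Z 0 - Z 3), 0]

/-- The Hodge dual of `skewMatrix Z`. -/
def skewMatrixDual (Z : Fin (3 + 3) → ℝ) : Matrix (Fin 4) (Fin 4) ℝ :=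
  !![0, Z 0 - Z 3, Z 1 - Z 4, Z 2 - Z 5;
    -(Z 0 - Z 3), 0, Z 2 + Z 5, -(Z 1 + Z 4);
    -(Z 1 - Z 4), -(Z 2 + Z 5), 0, Z 0 + Z 3;
    -(Z 2 - Z 5), Z 1 + Z 4, -(Z 0 + Z 3), 0]

/-- The Clifford action of `ℝ^{3,3}`, identified with `Λ²ℝ⁴`, on `ℝ⁴ ⊕ (ℝ⁴)*`. -/
def splitAction : (Fin (3 + 3) → ℝ) →ₗ[ℝ]
    ((Fin 4 → ℝ) × (Fin 4 → ℝ)) →ₗ[ℝ] ((Fin 4 → ℝ) × (Fin 4 → ℝ)) :=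
  LinearMap.mk₂ ℝ
    (fun Z v => ((skewMatrix Z).mulVec v.2, (skewMatrixDual Z).mulVec v.1))
    (fun Z W v => by
      ext i <;> fin_cases i <;>
        simp [skewMatrix, skewMatrixDual, Matrix.mulVec, dotProduct, Fin.sum_univ_four] <;> ring)
    (fun c Z v => by
      ext i <;> fin_cases i <;>
        simp [skewMatrix, skewMatrixDual, Matrix.mulVec, dotProduct, Fin.sum_univ_four] <;> ring)
    (fun Z v w => by simp [Matrix.mulVec_add])
    (fun c Z v => by simp [Matrix.mulVec_smul])

/-- The duality pairing on `ℝ⁴ ⊕ (ℝ⁴)*`. -/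
def splitForm : ((Fin 4 → ℝ) × (Fin 4 → ℝ)) →ₗ[ℝ] ((Fin 4 → ℝ) × (Fin 4 → ℝ)) →ₗ[ℝ] ℝ :=
  LinearMap.mk₂ ℝ (fun v w => v.1 ⬝ᵥ w.2 + v.2 ⬝ᵥ w.1)
    (fun u v w => by simp only [Prod.fst_add, Prod.snd_add, add_dotProduct]; ring)
    (fun c v w => by simp [mul_add])
    (fun u v w => by simp only [Prod.fst_add, Prod.snd_add, dotProduct_add]; ring)
    (fun c v w => by simp [mul_add])

theorem isAdmissible_split :
    IsAdmissible 3 3 ((Fin 4 → ℝ) × (Fin 4 → ℝ)) splitForm splitAction := by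
  refine ⟨inferInstance, inferInstance, fun v w => ?_, fun v hv => ?_, fun Z v => ?_,
    fun Z v w => ?_⟩
  · simp only [splitForm, LinearMap.mk₂_apply, dotProduct_comm w.1, dotProduct_comm w.2]
    ring
  · ext i
    · simpa [splitForm] using hv (0, Pi.single i 1)
    · simpa [splitForm] using hv (Pi.single i 1, 0)
  · ext i <;> fin_cases i <;>
      simp [splitAction, skewMatrix, skewMatrixDual, dotProduct, sform, Fin.sum_univ_succ] <;> ring
  · simp [splitAction, splitForm, skewMatrix, skewMatrixDual, dotProduct, Fin.sum_univ_four]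
    ring

end SplitModule

theorem stmt15
    (V1 : Type) [AddCommGroup V1] [Module ℝ V1]
    (B1 : V1 →ₗ[ℝ] V1 →ₗ[ℝ] ℝ)
    (J1 : (Fin (3 + 3) → ℝ) →ₗ[ℝ] V1 →ₗ[ℝ] V1)
    (br1 : V1 →ₗ[ℝ] V1 →ₗ[ℝ] (Fin (3 + 3) → ℝ))
    (hadm1 : IsMinimalAdmissible 3 3 V1 B1 J1)
    (hbr1 : IsHBracket 3 3 V1 B1 J1 br1)
    :
    ∀ X : V1, Function.Surjective ⇑(br1 X) ↔ B1 X X ≠ 0 := by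
  intro X
  rw [hadm1.1.surjective_bracket_iff hbr1]
  refine ⟨fun hinj hX => ?_, hadm1.1.injective_of_apply_self_ne_zero⟩
  have hlower := hadm1.1.two_mul_le_finrank hX hinj
  have hupper := hadm1.2 _ splitForm splitAction isAdmissible_split
  rw [Module.finrank_prod, Module.finrank_fin_fun] at hupper
  omega
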